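/- arXiv:math/0607459 — 2 statements merged into one kernel-verified Lean document; each statement's English description precedes it below -/
import Mathlib

section
/- Define F : ℕ → ℕ by F 0 = 3 and F (k+1) = (F k)! (the iterated factorial of 3). Then for every natural number N ≥ 4, log(log(F N)) > 8·N, where log is the real natural logarithm. -/
def F : ℕ → ℕ
  | 0 => 3
  | k + 1 => Nat.factorial (F k)

theorem two_pow_le_factorial_succ (n : ℕ) : 2 ^ n ≤ Nat.factorial (n + 1) := by
  simpa [add_comm] using Nat.factorial_mul_pow_le_factorial (m := 1) (n := n)

theorem mul_pred_le_factorial {n : ℕ} (hn : 1 ≤ n) : n * (n - 1) ≤ Nat.factorial n := by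
  obtain ⟨m, rfl⟩ := Nat.exists_eq_add_of_le' hn
  rw [Nat.factorial_succ, Nat.add_sub_cancel]
  exact Nat.mul_le_mul_left _ (Nat.self_le_factorial m)

theorem iterFactorial_two : F 2 = 720 := by
  simp [F, Nat.factorial]

theorem three_pow_le_iterFactorial (k : ℕ) (hk : 3 ≤ k) : 3 ^ (8 * (k + 1) + 1) ≤ F k := by
  induction k, hk using Nat.le_induction with
  | base =>
    rw [F, iterFactorial_two]
    calc 3 ^ (8 * (3 + 1) + 1) ≤ 2 ^ 66 := by norm_num
      _ ≤ Nat.factorial (66 + 1) := two_pow_le_factorial_succ 66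
      _ ≤ _ := Nat.factorial_le (by norm_num)
  | succ k _ ih =>
    have h9 : 3 ^ 9 ≤ F k :=
      (Nat.pow_le_pow_right (by norm_num) (by omega)).trans ih
    calc 3 ^ (8 * (k + 1 + 1) + 1) = 3 ^ (8 * (k + 1) + 1) * 3 ^ 8 := by ring
      _ ≤ F k * (F k - 1) := Nat.mul_le_mul ih (by omega)
      _ ≤ F (k + 1) := mul_pred_le_factorial (by omega)

theorem log_log_iterFactorial_gt (N : ℕ) (hN : 4 ≤ N) :
    Real.log (Real.log (F N)) > 8 * N := by
  obtain ⟨k, rfl⟩ := Nat.exists_eq_add_of_le' (show 1 ≤ N by omega)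
  have hF := three_pow_le_iterFactorial k (by omega)
  obtain ⟨m, hm⟩ := Nat.exists_eq_add_of_le' ((Nat.one_le_pow _ _ (by norm_num)).trans hF)
  have hm3 : (3 : ℝ) * 3 ^ (8 * (k + 1)) ≤ m + 1 := by
    rw [hm, pow_succ'] at hF
    exact_mod_cast hF
  have hexp : Real.exp (8 * (k + 1 : ℕ)) < 3 ^ (8 * (k + 1)) := by
    have h : Real.exp (8 * (k + 1 : ℕ)) = Real.exp 1 ^ (8 * (k + 1)) := by
      rw [← Real.exp_nat_mul]
      push_cast
      ring_nf
    rw [h]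
    exact pow_lt_pow_left₀ Real.exp_one_lt_three (Real.exp_pos 1).le (by omega)
  have hone : (1 : ℝ) ≤ 3 ^ (8 * (k + 1)) := one_le_pow₀ (by norm_num)
  have hlog : m * Real.log 2 ≤ Real.log (F (k + 1)) := by
    rw [← Real.log_pow, F, hm]
    exact Real.log_le_log (by positivity) (by exact_mod_cast two_pow_le_factorial_succ m)
  have hlarge : Real.exp (8 * (k + 1 : ℕ)) < Real.log (F (k + 1)) := by
    have h2 := Real.log_two_gt_d9
    nlinarith
  exact (Real.lt_log_iff_exp_lt ((Real.exp_pos _).trans hlarge)).2 hlarge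
end

section
/- Let L₁, L₂, k, c be natural numbers, set L = 2·L₁ + 6·L₂ + c, and assume L₂ > 4, L₂ > 2·L₁ + c + 1, and 2^L₂ > 7·L₂·(4·k + 39). Let a : ℕ → ℕ satisfy a i ≤ 4·k + 39 for every i ≤ L. Define F : ℕ → ℕ by F 0 = 3 and F (k+1) = (F k)! (the iterated factorial of 3). Then the product over i from 0 to L of p_i^(a i) is strictly less than F L₂, where p_i denotes the (i+1)-th prime number. -/
theorem nth_prime_le_two_pow (i : ℕ) : Nat.nth Nat.Prime i ≤ 2 ^ (i + 1) := by
  induction i with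
  | zero => simp [Nat.nth_prime_zero_eq_two]
  | succ i ih =>
    obtain ⟨q, hq, hlt, hle⟩ :=
      Nat.exists_prime_lt_and_le_two_mul _ (Nat.prime_nth_prime i).ne_zero
    have hcount : i < Nat.count Nat.Prime q := by
      rw [← Nat.nth_count hq] at hlt
      exact (Nat.nth_lt_nth Nat.infinite_setOfPred_prime).1 hlt
    have hsucc : Nat.nth Nat.Prime (i + 1) ≤ q := by
      rw [← Nat.nth_count hq]
      exact (Nat.nth_le_nth Nat.infinite_setOfPred_prime).2 hcount
    rw [pow_succ]
    omega

theorem two_pow_le_factorial {n : ℕ} (hn : 4 ≤ n) : 2 ^ n ≤ n.factorial := by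
  induction n, hn using Nat.le_induction with
  | base => decide
  | succ n hn ih =>
    rw [pow_succ, Nat.factorial_succ, mul_comm]
    exact Nat.mul_le_mul (by omega) ih

theorem four_mul_le_two_pow {n : ℕ} (hn : 4 ≤ n) : 4 * n ≤ 2 ^ n := by
  induction n, hn using Nat.le_induction with
  | base => decide
  | succ n hn ih =>
    rw [pow_succ]
    omega

theorem mul_two_pow_le_F {n : ℕ} (hn : 2 ≤ n) : 7 * (n + 1) * 2 ^ (n + 1) ≤ F n := by
  induction n, hn using Nat.le_induction with
  | base => decide
  | succ n hn ih =>
    have hF : 4 ≤ F n := by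
      have := Nat.one_le_two_pow (n := n + 1)
      nlinarith
    calc 7 * (n + 1 + 1) * 2 ^ (n + 1 + 1)
        ≤ 4 * (7 * (n + 1) * 2 ^ (n + 1)) := by
          rw [pow_succ 2 (n + 1)]
          nlinarith [Nat.one_le_two_pow (n := n + 1)]
      _ ≤ 4 * F n := Nat.mul_le_mul_left _ ih
      _ ≤ 2 ^ F n := four_mul_le_two_pow hF
      _ ≤ F (n + 1) := two_pow_le_factorial hF

theorem prod_nth_prime_pow_le (N M : ℕ) (a : ℕ → ℕ) (ha : ∀ i < N, a i ≤ M) :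
    ∏ i ∈ Finset.range N, Nat.nth Nat.Prime i ^ a i ≤ 2 ^ (N * M * N) := by
  calc ∏ i ∈ Finset.range N, Nat.nth Nat.Prime i ^ a i
      ≤ ∏ _i ∈ Finset.range N, 2 ^ (N * M) := by
        refine Finset.prod_le_prod' fun i hi => ?_
        have hi := Finset.mem_range.1 hi
        calc Nat.nth Nat.Prime i ^ a i ≤ (2 ^ (i + 1)) ^ a i :=
              Nat.pow_le_pow_left (nth_prime_le_two_pow i) _
          _ = 2 ^ ((i + 1) * a i) := (pow_mul _ _ _).symm
          _ ≤ 2 ^ (N * M) :=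
              Nat.pow_le_pow_right two_pos (Nat.mul_le_mul hi (ha i hi))
    _ = 2 ^ (N * M * N) := by
        rw [Finset.prod_const, Finset.card_range, ← pow_mul]

theorem godelCode_lt_iterFactorial (L₁ L₂ k c : ℕ)
    (hL₂4 : L₂ > 4) (hL₂ : L₂ > 2 * L₁ + c + 1) (hpow : 2 ^ L₂ > 7 * L₂ * (4 * k + 39))
    (a : ℕ → ℕ) (ha : ∀ i ≤ 2 * L₁ + 6 * L₂ + c, a i ≤ 4 * k + 39) :
    ∏ i ∈ Finset.range (2 * L₁ + 6 * L₂ + c + 1), (Nat.nth Nat.Prime i) ^ (a i) <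
      F L₂ := by
  refine (prod_nth_prime_pow_le _ (4 * k + 39) a fun i hi => ha i (by omega)).trans_lt ?_
  have hN : 2 * L₁ + 6 * L₂ + c + 1 ≤ 7 * L₂ := by omega
  obtain ⟨n, rfl⟩ : ∃ n, L₂ = n + 1 := ⟨L₂ - 1, by omega⟩
  have hF := mul_two_pow_le_F (n := n) (by omega)
  refine lt_of_lt_of_le (Nat.pow_lt_pow_right one_lt_two (lt_of_lt_of_le ?_ hF))
    (two_pow_le_factorial ?_)
  · calc _ ≤ 7 * (n + 1) * (4 * k + 39) * (7 * (n + 1)) := by gcongr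
      _ < 2 ^ (n + 1) * (7 * (n + 1)) := Nat.mul_lt_mul_of_pos_right hpow (by omega)
      _ = _ := mul_comm _ _
  · nlinarith [Nat.one_le_two_pow (n := n + 1)]
end
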